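/- arXiv:math-ph/0404020 — 2 statements merged into one kernel-verified Lean document; each statement's English description precedes it below -/
import Mathlib

section
/- Let w = (w_{⟨z,z+1⟩})_{z∈ℤ} be strictly positive and suppose that for some 0<κ<∞ both (1/n)·Σ_{z=0}^{n-1} 1/w_{⟨z,z+1⟩} → κ^{-1} and (1/n)·Σ_{z=1}^{n} 1/w_{⟨−z,−z+1⟩} → κ^{-1} as n→∞. For each L≥1 define η_L^{-1} = Σ_{y=−L+1}^{L} 1/w_{⟨y−1,y⟩}, (ξ_L)_x = η_L·Σ_{y=−L+1}^{x} 1/w_{⟨y−1,y⟩}, and ζ_L = 2ξ_L − 1. Then 2Lη_L → κ as L→∞, and for every ε>0 there exists an integer L₀ such that |(ζ_L)_{[Lr]} − r| < ε holds for all L>L₀ and all r∈(−1,1), where [Lr] is the integer part of Lr. -/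
open scoped BigOperators
open Filter

/-- The antiderivative on `ℤ` of `f : ℤ → ℝ` vanishing at `0`. -/
noncomputable def intPrimitive (f : ℤ → ℝ) (x : ℤ) : ℝ :=
  ∑ z ∈ Finset.range x.toNat, f z - ∑ z ∈ Finset.range (-x).toNat, f (-(z : ℤ) - 1)

theorem intPrimitive_natCast (f : ℤ → ℝ) (n : ℕ) :
    intPrimitive f n = ∑ z ∈ Finset.range n, f z := by
  simp [intPrimitive]

theorem intPrimitive_neg_natCast (f : ℤ → ℝ) (n : ℕ) :
    intPrimitive f (-(n : ℤ)) = -∑ z ∈ Finset.range n, f (-(z : ℤ) - 1) := by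
  simp [intPrimitive]

theorem intPrimitive_add_one (f : ℤ → ℝ) (x : ℤ) :
    intPrimitive f (x + 1) = intPrimitive f x + f x := by
  rcases le_or_gt 0 x with h | h
  · lift x to ℕ using h
    rw [← Nat.cast_succ, intPrimitive_natCast, intPrimitive_natCast, Finset.sum_range_succ]
  · obtain ⟨n, rfl⟩ : ∃ n : ℕ, x = -((n + 1 : ℕ) : ℤ) :=
      ⟨(-x - 1).toNat, by omega⟩
    have h1 : -((n + 1 : ℕ) : ℤ) + 1 = -(n : ℤ) := by push_cast; ring
    have h2 : -((n + 1 : ℕ) : ℤ) = -(n : ℤ) - 1 := by push_cast; ring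
    rw [h1, intPrimitive_neg_natCast, intPrimitive_neg_natCast, Finset.sum_range_succ, h2]
    ring

theorem sum_Icc_eq_intPrimitive_sub (f : ℤ → ℝ) {a b : ℤ} (hab : a ≤ b) :
    ∑ y ∈ Finset.Icc (a + 1) b, f (y - 1) = intPrimitive f b - intPrimitive f a := by
  induction b, hab using Int.leInduction with
  | base => simp
  | succ b hab ih =>
    have h : Finset.Icc (a + 1) (b + 1) = insert (b + 1) (Finset.Icc (a + 1) b) := by
      ext y
      simp only [Finset.mem_Icc, Finset.mem_insert]
      omega
    rw [h, Finset.sum_insert (by simp), ih, intPrimitive_add_one, add_sub_cancel_right]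
    ring

/-- A sequence with `u n / n → c` satisfies `|u n - c n| ≤ δ n + C` for all `n`. -/
theorem exists_abs_sub_mul_le_of_tendsto {u : ℕ → ℝ} {c : ℝ}
    (hu : Tendsto (fun n : ℕ => (1 / (n : ℝ)) * u n) atTop (nhds c)) {δ : ℝ} (hδ : 0 < δ) :
    ∃ C : ℝ, 0 ≤ C ∧ ∀ n : ℕ, |u n - c * n| ≤ δ * n + C := by
  obtain ⟨N, hN⟩ := Metric.tendsto_atTop.1 hu δ hδ
  refine ⟨∑ n ∈ Finset.range (N + 1), |u n - c * n|,
    Finset.sum_nonneg fun _ _ => abs_nonneg _, fun n => ?_⟩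
  rcases lt_or_ge n (N + 1) with h | h
  · have := Finset.single_le_sum (f := fun n : ℕ => |u n - c * n|)
      (fun _ _ => abs_nonneg _) (Finset.mem_range.2 h)
    have : 0 ≤ δ * n := by positivity
    linarith
  · have hn : (0 : ℝ) < n := by exact_mod_cast (show 0 < n by omega)
    have h1 := hN n (by omega)
    rw [Real.dist_eq] at h1
    have h2 : u n - c * n = (1 / (n : ℝ) * u n - c) * n := by field_simp
    have h3 : 0 ≤ ∑ n ∈ Finset.range (N + 1), |u n - c * n| :=
      Finset.sum_nonneg fun _ _ => abs_nonneg _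
    rw [h2, abs_mul, abs_of_pos hn]
    nlinarith

theorem exists_abs_intPrimitive_sub_le {f : ℤ → ℝ} {c : ℝ}
    (hplus : Tendsto (fun n : ℕ => (1 / (n : ℝ)) * ∑ z ∈ Finset.range n, f z) atTop (nhds c))
    (hminus : Tendsto (fun n : ℕ => (1 / (n : ℝ)) * ∑ z ∈ Finset.range n, f (-(z : ℤ) - 1))
      atTop (nhds c)) {δ : ℝ} (hδ : 0 < δ) :
    ∃ C : ℝ, 0 ≤ C ∧ ∀ x : ℤ, |intPrimitive f x - c * x| ≤ δ * |(x : ℝ)| + C := by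
  obtain ⟨C₁, h₁, H₁⟩ := exists_abs_sub_mul_le_of_tendsto hplus hδ
  obtain ⟨C₂, h₂, H₂⟩ := exists_abs_sub_mul_le_of_tendsto hminus hδ
  refine ⟨C₁ + C₂, add_nonneg h₁ h₂, fun x => ?_⟩
  obtain ⟨n, rfl | rfl⟩ := x.eq_nat_or_neg
  · have := H₁ n
    rw [intPrimitive_natCast, Int.cast_natCast, Nat.abs_cast]
    linarith
  · have := H₂ n
    rw [intPrimitive_neg_natCast, Int.cast_neg, Int.cast_natCast, abs_neg, Nat.abs_cast,
      mul_neg, neg_sub_neg, abs_sub_comm]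
    linarith

/-- Partial sums over `(-L, ⌊L r⌋]`, divided by `L`, converge uniformly in `r ∈ (-1, 1)`. -/
theorem eventually_abs_sum_Icc_div_sub_lt {f : ℤ → ℝ} {c : ℝ}
    (hplus : Tendsto (fun n : ℕ => (1 / (n : ℝ)) * ∑ z ∈ Finset.range n, f z) atTop (nhds c))
    (hminus : Tendsto (fun n : ℕ => (1 / (n : ℝ)) * ∑ z ∈ Finset.range n, f (-(z : ℤ) - 1))
      atTop (nhds c)) {ε : ℝ} (hε : 0 < ε) :
    ∀ᶠ L : ℕ in atTop, ∀ r ∈ Set.Ioo (-1 : ℝ) 1,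
      |(∑ y ∈ Finset.Icc (-(L : ℤ) + 1) ⌊(L : ℝ) * r⌋, f (y - 1)) / L - c * (r + 1)| < ε := by
  obtain ⟨C, hC, H⟩ := exists_abs_intPrimitive_sub_le hplus hminus (δ := ε / 4) (by positivity)
  have hlim : Tendsto (fun L : ℕ => ε / 2 * (L : ℝ)) atTop atTop :=
    tendsto_natCast_atTop_atTop.const_mul_atTop (by positivity)
  filter_upwards [hlim.eventually_gt_atTop (2 * C + |c|), eventually_gt_atTop 0] with L hL hL0 r hr
  have hLpos : (0 : ℝ) < L := by exact_mod_cast hL0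
  have hlow : -(L : ℤ) ≤ ⌊(L : ℝ) * r⌋ := by
    rw [Int.le_floor]
    push_cast
    nlinarith [hr.1]
  have hfl := Int.floor_le ((L : ℝ) * r)
  have hfl' := Int.sub_one_lt_floor ((L : ℝ) * r)
  have hlow' : -(L : ℝ) ≤ (⌊(L : ℝ) * r⌋ : ℝ) := by exact_mod_cast hlow
  have hx : |(⌊(L : ℝ) * r⌋ : ℝ)| ≤ L := abs_le.2 ⟨hlow', by nlinarith [hr.2]⟩
  rw [sum_Icc_eq_intPrimitive_sub f hlow]
  set x := ⌊(L : ℝ) * r⌋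
  have h1 := H x
  have h2 := H (-(L : ℤ))
  rw [Int.cast_neg, Int.cast_natCast, abs_neg, Nat.abs_cast] at h2
  have h3 : |c * (x - L * r)| ≤ |c| := by
    rw [abs_mul]
    exact mul_le_of_le_one_right (abs_nonneg c) (abs_le.2 ⟨by linarith, by linarith⟩)
  have h4 : ε / 4 * |(x : ℝ)| ≤ ε / 4 * L := by gcongr
  have h5 : (intPrimitive f x - intPrimitive f (-(L : ℤ))) / L - c * (r + 1) =
      ((intPrimitive f x - c * x) - (intPrimitive f (-(L : ℤ)) - c * -L)
        + c * (x - L * r)) / L := by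
    field_simp
    ring
  rw [h5, abs_div, abs_of_pos hLpos, div_lt_iff₀ hLpos]
  have h6 := abs_add_le ((intPrimitive f x - c * x) - (intPrimitive f (-(L : ℤ)) - c * -L))
    (c * (x - L * r))
  have h7 := abs_sub (intPrimitive f x - c * x) (intPrimitive f (-(L : ℤ)) - c * -L)
  linarith

/-- if the environment `w z = w_{⟨z,z+1⟩} > 0` has both one-sided Cesàro
averages of `1/w` converging to `κ⁻¹` with `0 < κ < ∞`, then with
`η_L⁻¹ = Σ_{y=-L+1}^{L} 1/w_{⟨y-1,y⟩}`, `(ξ_L)_x = η_L Σ_{y=-L+1}^{x} 1/w_{⟨y-1,y⟩}` and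
`ζ_L = 2ξ_L - 1`, one has `2Lη_L → κ` and `(ζ_L)_{[Lr]} → r` uniformly in `r ∈ (-1,1)`. -/
theorem zeta_converges_uniformly
    (w : ℤ → ℝ) (hw : ∀ z, 0 < w z) (κ : ℝ) (hκ : 0 < κ)
    (hplus : Tendsto (fun n : ℕ => (1 / (n : ℝ)) * ∑ z ∈ Finset.range n, (w (z : ℤ))⁻¹)
      atTop (nhds κ⁻¹))
    (hminus : Tendsto (fun n : ℕ => (1 / (n : ℝ)) * ∑ z ∈ Finset.range n, (w (-(z : ℤ) - 1))⁻¹)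
      atTop (nhds κ⁻¹))
    (η : ℕ → ℝ)
    (hη : ∀ L : ℕ, (η L)⁻¹ = ∑ y ∈ Finset.Icc (-(L : ℤ) + 1) (L : ℤ), (w (y - 1))⁻¹)
    (ζ : ℕ → ℤ → ℝ)
    (hζ : ∀ L : ℕ, ∀ x : ℤ,
      ζ L x = 2 * (η L * ∑ y ∈ Finset.Icc (-(L : ℤ) + 1) x, (w (y - 1))⁻¹) - 1) :
    Tendsto (fun L : ℕ => 2 * (L : ℝ) * η L) atTop (nhds κ) ∧
    ∀ ε > (0 : ℝ), ∃ L₀ : ℕ, ∀ L : ℕ, L₀ < L → ∀ r ∈ Set.Ioo (-1 : ℝ) 1,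
      |ζ L ⌊(L : ℝ) * r⌋ - r| < ε := by
  have hfirst : Tendsto (fun L : ℕ => 2 * (L : ℝ) * η L) atTop (nhds κ) := by
    have h := ((hplus.add hminus).inv₀ (by positivity)).const_mul 2
    have hκ' : 2 * (κ⁻¹ + κ⁻¹)⁻¹ = κ := by field_simp; norm_num
    rw [hκ'] at h
    refine h.congr fun L => ?_
    have hηL := hη L
    rw [sum_Icc_eq_intPrimitive_sub (fun z => (w z)⁻¹) (by omega), intPrimitive_natCast,
      intPrimitive_neg_natCast, sub_neg_eq_add] at hηL
    rw [← mul_add, ← hηL, mul_inv, inv_inv, one_div, inv_inv]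
    ring
  refine ⟨hfirst, fun ε hε => ?_⟩
  have hsum := eventually_abs_sum_Icc_div_sub_lt (f := fun z => (w z)⁻¹) hplus hminus
    (ε := ε / (4 * κ)) (by positivity)
  have hclose := Metric.tendsto_nhds.1 hfirst (min κ (ε * κ / 4)) (by positivity)
  obtain ⟨L₀, hL₀⟩ := eventually_atTop.1 (hsum.and (hclose.and (eventually_gt_atTop 0)))
  refine ⟨L₀, fun L hL r hr => ?_⟩
  obtain ⟨h1, h2, hL0⟩ := hL₀ L hL.le
  have hLpos : (0 : ℝ) < L := by exact_mod_cast hL0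
  specialize h1 r hr
  rw [Real.dist_eq, lt_min_iff] at h2
  rw [hζ]
  set S := ∑ y ∈ Finset.Icc (-(L : ℤ) + 1) ⌊(L : ℝ) * r⌋, (w (y - 1))⁻¹
  set v := 2 * (L : ℝ) * η L with hv
  have hdecomp : 2 * (η L * S) - 1 - r
      = v * (S / L - κ⁻¹ * (r + 1)) + κ⁻¹ * (r + 1) * (v - κ) := by
    rw [hv]
    field_simp
    ring
  have hvabs : |v| ≤ 2 * κ := by
    have := abs_lt.1 h2.1
    exact abs_le.2 ⟨by linarith, by linarith⟩
  have hA : |v * (S / L - κ⁻¹ * (r + 1))| ≤ ε / 2 := by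
    rw [abs_mul]
    calc |v| * |S / L - κ⁻¹ * (r + 1)| ≤ 2 * κ * (ε / (4 * κ)) := by gcongr
      _ = ε / 2 := by field_simp; norm_num
  have hr1 : 0 < r + 1 := by linarith [hr.1]
  have hB : |κ⁻¹ * (r + 1) * (v - κ)| < ε / 2 := by
    rw [abs_mul, abs_of_pos (by positivity)]
    calc κ⁻¹ * (r + 1) * |v - κ| < κ⁻¹ * (r + 1) * (ε * κ / 4) := by gcongr; exact h2.2
      _ = (r + 1) * ε / 4 := by field_simp
      _ ≤ ε / 2 := by nlinarith [hr.2]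
  rw [hdecomp]
  linarith [abs_add_le (v * (S / L - κ⁻¹ * (r + 1))) (κ⁻¹ * (r + 1) * (v - κ))]
end

section
/- Let w = (w_{⟨z,z+1⟩})_{z∈ℤ} be strictly positive and suppose that for some 0<κ<∞ both (1/n)·Σ_{z=0}^{n-1} 1/w_{⟨z,z+1⟩} → κ^{-1} and (1/n)·Σ_{z=1}^{n} 1/w_{⟨−z,−z+1⟩} → κ^{-1} as n→∞. For each L≥1 let Ξ_L^{-1}(r,s) = (1/L)·(Δ_{L,w}^{-1})_{[Lr],[Ls]} for r,s∈(−1,1), where Δ_{L,w}^{-1} is the inverse of the matrix Δ_{L,w} on ℝ^{{−L+1,…,L−1}}, and let G_κ(r,s) = −(1 − |r−s| − r·s)/(2κ). Then sup_{r,s∈(−1,1)} |Ξ_L^{-1}(r,s) − G_κ(r,s)| → 0 as L→∞. In particular there is a finite constant C and L₀ such that |Ξ_L^{-1}(r,s)| ≤ C for all r,s∈(−1,1) and all L>L₀. -/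
open scoped BigOperators
open Filter

/-- The scale function of the weights `w`: `S 0 = 0` and `S (x + 1) - S x = (w x)⁻¹`. -/
noncomputable def scaleFn (w : ℤ → ℝ) (x : ℤ) : ℝ :=
  ∑ z ∈ Finset.range x.toNat, (w (z : ℤ))⁻¹ -
    ∑ z ∈ Finset.range (-x).toNat, (w (-(z : ℤ) - 1))⁻¹

theorem scaleFn_succ (w : ℤ → ℝ) (x : ℤ) : scaleFn w (x + 1) = scaleFn w x + (w x)⁻¹ := by
  unfold scaleFn
  rcases lt_or_ge x 0 with hx | hx
  · obtain ⟨n, rfl⟩ : ∃ n : ℕ, x = -(n : ℤ) - 1 := ⟨(-x - 1).toNat, by lia⟩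
    have h1 : (-(n : ℤ) - 1 + 1).toNat = 0 := by lia
    have h2 : (-(n : ℤ) - 1).toNat = 0 := by lia
    have h3 : (-(-(n : ℤ) - 1 + 1)).toNat = n := by lia
    have h4 : (-(-(n : ℤ) - 1)).toNat = n + 1 := by lia
    rw [h1, h2, h3, h4, Finset.sum_range_succ]
    ring
  · obtain ⟨n, rfl⟩ := Int.eq_ofNat_of_zero_le hx
    have h1 : ((n : ℤ) + 1).toNat = n + 1 := by lia
    have h2 : (n : ℤ).toNat = n := by lia
    have h3 : (-((n : ℤ) + 1)).toNat = 0 := by lia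
    have h4 : (-(n : ℤ)).toNat = 0 := by lia
    rw [h1, h2, h3, h4, Finset.sum_range_succ]
    ring

theorem scaleFn_strictMono {w : ℤ → ℝ} (hw : ∀ z, 0 < w z) : StrictMono (scaleFn w) :=
  strictMono_int_of_lt_succ fun x => by
    rw [scaleFn_succ]
    exact lt_add_of_pos_right _ (inv_pos.2 (hw x))

/-- A function that is harmonic for the weights `w` strictly between `a` and `a + n` is an affine
function of the scale function. -/
theorem eq_add_mul_scaleFn_of_harmonic {w : ℤ → ℝ} (hw : ∀ z, 0 < w z) (u : ℤ → ℝ) (a : ℤ) (n : ℕ)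
    (hu : ∀ x, a < x → x < a + n → w (x - 1) * (u (x - 1) - u x) + w x * (u (x + 1) - u x) = 0)
    (k : ℕ) (hk : k ≤ n) :
    u (a + k) = u a + w a * (u (a + 1) - u a) * (scaleFn w (a + k) - scaleFn w a) := by
  have flux : ∀ k : ℕ, k < n →
      w (a + k) * (u (a + k + 1) - u (a + k)) = w a * (u (a + 1) - u a) := by
    intro k
    induction k with
    | zero => simp
    | succ k ih =>
      intro hk
      have h := hu (a + k + 1) (by lia) (by lia)
      rw [add_sub_cancel_right] at h
      have := ih (by lia)
      push_cast
      rw [← add_assoc]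
      linarith
  induction k with
  | zero => simp
  | succ k ih =>
    have h1 := ih (by lia)
    have h2 := flux k (by lia)
    push_cast
    rw [← add_assoc, scaleFn_succ]
    have h3 : u (a + k + 1) - u (a + k) = w a * (u (a + 1) - u a) * (w (a + k))⁻¹ := by
      rw [← h2]
      field_simp [(hw (a + k)).ne']
    linarith

/-- The Dirichlet problem for the weights `w` has only the zero solution. -/
theorem eq_zero_of_harmonic {w : ℤ → ℝ} (hw : ∀ z, 0 < w z) (u : ℤ → ℝ) {a b : ℤ} (hab : a < b)
    (hu : ∀ x, a < x → x < b → w (x - 1) * (u (x - 1) - u x) + w x * (u (x + 1) - u x) = 0)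
    (ha : u a = 0) (hb : u b = 0) {x : ℤ} (hax : a ≤ x) (hxb : x ≤ b) : u x = 0 := by
  obtain ⟨n, rfl⟩ : ∃ n : ℕ, b = a + n := ⟨(b - a).toNat, by lia⟩
  obtain ⟨k, rfl⟩ : ∃ k : ℕ, x = a + k := ⟨(x - a).toNat, by lia⟩
  have h := eq_add_mul_scaleFn_of_harmonic hw u a n hu
  have hn := h n le_rfl
  rw [hb, ha, zero_add, eq_comm, mul_eq_zero] at hn
  have hc := hn.resolve_right (sub_pos.2 (scaleFn_strictMono hw hab)).ne'
  rw [h k (by lia), ha, hc]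
  simp

/-- The inverse of the weighted Laplacian on `(a, b)` with Dirichlet boundary conditions. -/
noncomputable def dirichletKernel (w : ℤ → ℝ) (a b x y : ℤ) : ℝ :=
  -((scaleFn w (min x y) - scaleFn w a) * (scaleFn w b - scaleFn w (max x y)) /
    (scaleFn w b - scaleFn w a))

theorem dirichletKernel_laplacian {w : ℤ → ℝ} (hw : ∀ z, 0 < w z) {a b : ℤ} (hab : a < b)
    (x y : ℤ) :
    w (x - 1) * (dirichletKernel w a b (x - 1) y - dirichletKernel w a b x y) +
      w x * (dirichletKernel w a b (x + 1) y - dirichletKernel w a b x y) =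
        if x = y then 1 else 0 := by
  have hD : scaleFn w b - scaleFn w a ≠ 0 := (sub_pos.2 (scaleFn_strictMono hw hab)).ne'
  have h0 := (hw x).ne'
  have h1 := (hw (x - 1)).ne'
  have e1 : scaleFn w (x + 1) = scaleFn w x + (w x)⁻¹ := scaleFn_succ w x
  have e2 : scaleFn w (x - 1) = scaleFn w x - (w (x - 1))⁻¹ := by
    rw [eq_sub_iff_add_eq, ← scaleFn_succ, sub_add_cancel]
  unfold dirichletKernel
  rcases lt_trichotomy x y with h | rfl | h
  · rw [min_eq_left (by lia : x - 1 ≤ y), min_eq_left (by lia : x ≤ y),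
      min_eq_left (by lia : x + 1 ≤ y), max_eq_right (by lia : x - 1 ≤ y),
      max_eq_right (by lia : x ≤ y), max_eq_right (by lia : x + 1 ≤ y), if_neg h.ne, e1, e2]
    field_simp
    ring
  · rw [min_eq_left (by lia : x - 1 ≤ x), min_self, max_self, min_eq_right (by lia : x ≤ x + 1),
      max_eq_right (by lia : x - 1 ≤ x), max_eq_left (by lia : x ≤ x + 1), if_pos rfl, e1, e2]
    field_simp
    ring
  · rw [min_eq_right (by lia : y ≤ x - 1), min_eq_right (by lia : y ≤ x),
      min_eq_right (by lia : y ≤ x + 1), max_eq_left (by lia : y ≤ x - 1),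
      max_eq_left (by lia : y ≤ x), max_eq_left (by lia : y ≤ x + 1), if_neg h.ne', e1, e2]
    field_simp
    ring

theorem dirichletKernel_left {w : ℤ → ℝ} {a b y : ℤ} (hy : a ≤ y) :
    dirichletKernel w a b a y = 0 := by
  simp [dirichletKernel, min_eq_left hy]

theorem dirichletKernel_right {w : ℤ → ℝ} {a b y : ℤ} (hy : y ≤ b) :
    dirichletKernel w a b b y = 0 := by
  simp [dirichletKernel, max_eq_left hy]

theorem dirichletKernel_comm (w : ℤ → ℝ) (a b x y : ℤ) :
    dirichletKernel w a b x y = dirichletKernel w a b y x := by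
  rw [dirichletKernel, dirichletKernel, min_comm, max_comm]

/-- Convergence of averages gives uniform linear approximation on initial segments. -/
theorem exists_forall_abs_sub_mul_le {f : ℕ → ℝ} {c : ℝ}
    (hf : Tendsto (fun n : ℕ => (1 / (n : ℝ)) * f n) atTop (nhds c)) {ε : ℝ} (hε : 0 < ε) :
    ∃ N : ℕ, ∀ L ≥ N, ∀ n ≤ L, |f n - c * n| ≤ ε * L := by
  obtain ⟨N₁, hN₁⟩ := Metric.tendsto_atTop.1 hf ε hε
  set B := ∑ n ∈ Finset.range (N₁ + 1), |f n - c * n|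
  obtain ⟨N₂, hN₂⟩ := exists_nat_ge (B / ε)
  refine ⟨N₂, fun L hL n hn => ?_⟩
  have hLn : (n : ℝ) ≤ L := by exact_mod_cast hn
  have hL2 : (N₂ : ℝ) ≤ L := by exact_mod_cast hL
  rcases Nat.lt_or_ge n (N₁ + 1) with h | h
  · have h1 : |f n - c * n| ≤ B :=
      Finset.single_le_sum (f := fun n : ℕ => |f n - c * n|) (fun _ _ => abs_nonneg _)
        (Finset.mem_range.2 h)
    have h2 : B ≤ L * ε := (div_le_iff₀ hε).1 (hN₂.trans hL2)
    linarith
  · have hn0 : (0 : ℝ) < n := by exact_mod_cast (by lia : 0 < n)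
    have h1 := (hN₁ n (by lia)).le
    rw [Real.dist_eq] at h1
    have h2 : f n - c * n = n * (1 / (n : ℝ) * f n - c) := by
      field_simp
    rw [h2, abs_mul, abs_of_pos hn0]
    nlinarith

theorem exists_forall_abs_scaleFn_sub_le {w : ℤ → ℝ} {c : ℝ}
    (hplus : Tendsto (fun n : ℕ => (1 / (n : ℝ)) * ∑ z ∈ Finset.range n, (w (z : ℤ))⁻¹)
      atTop (nhds c))
    (hminus : Tendsto (fun n : ℕ => (1 / (n : ℝ)) * ∑ z ∈ Finset.range n, (w (-(z : ℤ) - 1))⁻¹)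
      atTop (nhds c)) {ε : ℝ} (hε : 0 < ε) :
    ∃ N : ℕ, ∀ L : ℕ, N ≤ L → ∀ x : ℤ, -(L : ℤ) ≤ x → x ≤ L →
      |scaleFn w x - c * x| ≤ ε * L := by
  obtain ⟨N₁, h₁⟩ := exists_forall_abs_sub_mul_le hplus hε
  obtain ⟨N₂, h₂⟩ := exists_forall_abs_sub_mul_le hminus hε
  refine ⟨max N₁ N₂, fun L hL x hx1 hx2 => ?_⟩
  rcases le_total 0 x with hx | hx
  · obtain ⟨n, rfl⟩ := Int.eq_ofNat_of_zero_le hx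
    simpa [scaleFn] using h₁ L (le_trans (le_max_left _ _) hL) n (by lia)
  · obtain ⟨n, rfl⟩ : ∃ n : ℕ, x = -(n : ℤ) := ⟨(-x).toNat, by lia⟩
    have h := h₂ L (le_trans (le_max_right _ _) hL) n (by lia)
    rw [← abs_neg] at h
    convert h using 2
    simp [scaleFn]
    ring

theorem abs_mul_div_sub_mul_div_le {P Q D p q d δ : ℝ} (hP : 0 ≤ P) (hPD : P ≤ D) (hD : 0 < D)
    (hq : 0 ≤ q) (hqd : q ≤ d) (hd : 0 < d) (h₁ : |P - p| ≤ δ) (h₂ : |Q - q| ≤ δ)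
    (h₃ : |D - d| ≤ δ) : |P * Q / D - p * q / d| ≤ 3 * δ := by
  have e : P * Q / D - p * q / d =
      P / D * (Q - q) + q / d * (P / D * (d - D) + (P - p)) := by
    field_simp
    ring
  have hPD0 : 0 ≤ P / D := by positivity
  have hPD1 : P / D ≤ 1 := (div_le_one hD).2 hPD
  have hqd0 : 0 ≤ q / d := by positivity
  have hqd1 : q / d ≤ 1 := (div_le_one hd).2 hqd
  have contr : ∀ {t x η : ℝ}, 0 ≤ t → t ≤ 1 → |x| ≤ η → |t * x| ≤ η := by
    intro t x η h0 h1 hx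
    rw [abs_mul, abs_of_nonneg h0]
    exact (mul_le_of_le_one_left (abs_nonneg x) h1).trans hx
  rw [abs_sub_comm] at h₃
  have := contr hPD0 hPD1 h₂
  have h4 := contr hPD0 hPD1 h₃
  have h5 : |P / D * (d - D) + (P - p)| ≤ 2 * δ := (abs_add_le _ _).trans (by linarith)
  have := contr hqd0 hqd1 h5
  rw [e]
  exact (abs_add_le _ _).trans (by linarith)

theorem one_sub_abs_sub_sub_mul (r s : ℝ) :
    1 - |r - s| - r * s = (min r s + 1) * (1 - max r s) := by
  rcases le_total r s with h | h
  · rw [min_eq_left h, max_eq_right h, abs_of_nonpos (by linarith)]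
    ring
  · rw [min_eq_right h, max_eq_left h, abs_of_nonneg (by linarith)]
    ring

theorem floor_natCast_mul_bounds (L : ℕ) {t : ℝ} (ht₁ : -1 ≤ t) (ht₂ : t ≤ 1) :
    -(L : ℤ) ≤ ⌊(L : ℝ) * t⌋ ∧ ⌊(L : ℝ) * t⌋ ≤ L := by
  have hL : (0 : ℝ) ≤ L := L.cast_nonneg
  refine ⟨Int.le_floor.2 (by push_cast; nlinarith), ?_⟩
  have : (⌊(L : ℝ) * t⌋ : ℝ) ≤ L := (Int.floor_le _).trans (by nlinarith)
  exact_mod_cast this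

/-- After rescaling, the kernel `dirichletKernel w (-L) L` is uniformly close to the Green's
function of `κ d²/dr²` on `(-1, 1)`. -/
theorem exists_forall_abs_dirichletKernel_sub_lt {w : ℤ → ℝ} (hw : ∀ z, 0 < w z) {κ : ℝ}
    (hκ : 0 < κ)
    (hplus : Tendsto (fun n : ℕ => (1 / (n : ℝ)) * ∑ z ∈ Finset.range n, (w (z : ℤ))⁻¹)
      atTop (nhds κ⁻¹))
    (hminus : Tendsto (fun n : ℕ => (1 / (n : ℝ)) * ∑ z ∈ Finset.range n, (w (-(z : ℤ) - 1))⁻¹)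
      atTop (nhds κ⁻¹)) {ε : ℝ} (hε : 0 < ε) :
    ∃ L₀ : ℕ, ∀ L : ℕ, L₀ < L → ∀ r ∈ Set.Ioo (-1 : ℝ) 1, ∀ s ∈ Set.Ioo (-1 : ℝ) 1,
      |(1 / (L : ℝ)) * dirichletKernel w (-L) L ⌊(L : ℝ) * r⌋ ⌊(L : ℝ) * s⌋ -
        (-(1 - |r - s| - r * s) / (2 * κ))| < ε := by
  set δ := ε / 13 with hδ
  have hδ0 : 0 < δ := by positivity
  obtain ⟨N₁, h₁⟩ := exists_forall_abs_scaleFn_sub_le hplus hminus hδ0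
  obtain ⟨N₂, h₂⟩ := exists_nat_ge (κ⁻¹ / δ)
  refine ⟨max N₁ N₂, fun L hL r hr s hs => ?_⟩
  have hL1 : N₁ ≤ L := (le_max_left _ _).trans hL.le
  have hL2 : (N₂ : ℝ) ≤ L := by exact_mod_cast (le_max_right _ _).trans hL.le
  have hLpos : (0 : ℝ) < L := by exact_mod_cast (by lia : 0 < L)
  have hκ' : 0 < κ⁻¹ := inv_pos.2 hκ
  have hmono := scaleFn_strictMono hw
  have hκL : κ⁻¹ ≤ L * δ := (div_le_iff₀ hδ0).1 (h₂.trans hL2)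
  set A : ℝ → ℝ := fun t => scaleFn w ⌊(L : ℝ) * t⌋ / L with hA
  have hAmono : Monotone A := fun t t' h => by
    have : ⌊(L : ℝ) * t⌋ ≤ ⌊(L : ℝ) * t'⌋ := Int.floor_mono (by gcongr)
    have := hmono.monotone this
    simp only [hA]
    gcongr
  have hAapprox : ∀ t, -1 ≤ t → t ≤ 1 → |A t - κ⁻¹ * t| ≤ 2 * δ := by
    intro t ht1 ht2
    obtain ⟨hx1, hx2⟩ := floor_natCast_mul_bounds L ht1 ht2
    have h := h₁ L hL1 _ hx1 hx2
    have hf1 := Int.floor_le ((L : ℝ) * t)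
    have hf2 := Int.lt_floor_add_one ((L : ℝ) * t)
    have hfl : |κ⁻¹ * (⌊(L : ℝ) * t⌋ - L * t)| ≤ L * δ := by
      rw [abs_mul, abs_of_pos hκ']
      have : |(⌊(L : ℝ) * t⌋ : ℝ) - L * t| ≤ 1 := abs_le.2 ⟨by linarith, by linarith⟩
      nlinarith
    have e : A t - κ⁻¹ * t = ((scaleFn w ⌊(L : ℝ) * t⌋ - κ⁻¹ * ⌊(L : ℝ) * t⌋) +
        κ⁻¹ * (⌊(L : ℝ) * t⌋ - L * t)) / L := by
      simp only [hA]
      field_simp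
      ring
    rw [e, abs_div, abs_of_pos hLpos, div_le_iff₀ hLpos]
    exact (abs_add_le _ _).trans (by linarith)
  obtain ⟨hr1, hr2⟩ := hr
  obtain ⟨hs1, hs2⟩ := hs
  set m := min r s with hm
  set M := max r s with hM
  have hm1 : -1 < m := lt_min hr1 hs1
  have hm2 : m < 1 := (min_le_left _ _).trans_lt hr2
  have hM1 : -1 < M := hr1.trans_le (le_max_left _ _)
  have hM2 : M < 1 := max_lt hr2 hs2
  have hA1 : A 1 = scaleFn w L / L := by simp [hA]
  have hA2 : A (-1) = scaleFn w (-L) / L := by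
    simp only [hA, mul_neg, mul_one]
    rw [show (-(L : ℝ)) = ((-(L : ℤ) : ℤ) : ℝ) by push_cast; rfl, Int.floor_intCast]
  have hS : scaleFn w (-L) < scaleFn w L := hmono (by lia)
  have hflo : Monotone fun t : ℝ => ⌊(L : ℝ) * t⌋ := fun t t' h => Int.floor_mono (by gcongr)
  have hK : (1 / (L : ℝ)) * dirichletKernel w (-L) L ⌊(L : ℝ) * r⌋ ⌊(L : ℝ) * s⌋ =
      -((A m - A (-1)) * (A 1 - A M) / (A 1 - A (-1))) := by
    have e1 : min ⌊(L : ℝ) * r⌋ ⌊(L : ℝ) * s⌋ = ⌊(L : ℝ) * m⌋ := (hflo.map_min).symm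
    have e2 : max ⌊(L : ℝ) * r⌋ ⌊(L : ℝ) * s⌋ = ⌊(L : ℝ) * M⌋ := (hflo.map_max).symm
    have hS' := (sub_pos.2 hS).ne'
    rw [dirichletKernel, e1, e2, hA1, hA2]
    simp only [hA]
    field_simp
  have hG : -(1 - |r - s| - r * s) / (2 * κ) =
      -((κ⁻¹ * (m + 1)) * (κ⁻¹ * (1 - M)) / (κ⁻¹ * 2)) := by
    rw [one_sub_abs_sub_sub_mul, ← hm, ← hM]
    field_simp
  have bm := abs_le.1 (hAapprox m hm1.le hm2.le)
  have bM := abs_le.1 (hAapprox M hM1.le hM2.le)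
  have b1 := abs_le.1 (hAapprox 1 (by norm_num) le_rfl)
  have b2 := abs_le.1 (hAapprox (-1) le_rfl (by norm_num))
  have hD : 0 < A 1 - A (-1) := by
    rw [hA1, hA2, ← sub_div]
    exact div_pos (sub_pos.2 hS) hLpos
  have key := abs_mul_div_sub_mul_div_le (P := A m - A (-1)) (Q := A 1 - A M)
    (D := A 1 - A (-1)) (p := κ⁻¹ * (m + 1)) (q := κ⁻¹ * (1 - M)) (d := κ⁻¹ * 2) (δ := 4 * δ)
    (sub_nonneg.2 (hAmono hm1.le)) (sub_le_sub_right (hAmono hm2.le) _) hD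
    (mul_nonneg hκ'.le (by linarith)) (mul_le_mul_of_nonneg_left (by linarith) hκ'.le)
    (by positivity) (abs_le.2 ⟨by linarith, by linarith⟩) (abs_le.2 ⟨by linarith, by linarith⟩)
    (abs_le.2 ⟨by linarith, by linarith⟩)
  rw [hK, hG, neg_sub_neg, abs_sub_comm]
  linarith

/-- let `w z = w_{⟨z,z+1⟩} > 0` satisfy the two-sided Cesàro condition
with limit `κ⁻¹`, `0 < κ < ∞`.  For each `L` let `K L` be the (zero-extended) inverse
matrix of `Δ_{L,w}` on `ℝ^{{-L+1,…,L-1}}`, and set `Ξ_L⁻¹(r,s) = (1/L) K L ⌊Lr⌋ ⌊Ls⌋`.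
Then `Ξ_L⁻¹(r,s) → G_κ(r,s) = -(1-|r-s|-rs)/(2κ)` uniformly on `(-1,1)²`; in particular
`|Ξ_L⁻¹|` is uniformly bounded for large `L`. -/
theorem scaled_inverse_kernel_converges_to_green_function
    (w : ℤ → ℝ) (hw : ∀ z, 0 < w z) (κ : ℝ) (hκ : 0 < κ)
    (hplus : Tendsto (fun n : ℕ => (1 / (n : ℝ)) * ∑ z ∈ Finset.range n, (w (z : ℤ))⁻¹)
      atTop (nhds κ⁻¹))
    (hminus : Tendsto (fun n : ℕ => (1 / (n : ℝ)) * ∑ z ∈ Finset.range n, (w (-(z : ℤ) - 1))⁻¹)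
      atTop (nhds κ⁻¹))
    (K : ℕ → ℤ → ℤ → ℝ)
    (hKsupp : ∀ L : ℕ, ∀ x y : ℤ,
      x ∉ Finset.Icc (-(L : ℤ) + 1) ((L : ℤ) - 1) ∨
      y ∉ Finset.Icc (-(L : ℤ) + 1) ((L : ℤ) - 1) → K L x y = 0)
    (hKinv : ∀ L : ℕ, 1 ≤ L →
      ∀ x ∈ Finset.Icc (-(L : ℤ) + 1) ((L : ℤ) - 1),
      ∀ y ∈ Finset.Icc (-(L : ℤ) + 1) ((L : ℤ) - 1),
        w (x - 1) * (K L (x - 1) y - K L x y) + w x * (K L (x + 1) y - K L x y) =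
          if x = y then 1 else 0) :
    (∀ ε > (0 : ℝ), ∃ L₀ : ℕ, ∀ L : ℕ, L₀ < L →
      ∀ r ∈ Set.Ioo (-1 : ℝ) 1, ∀ s ∈ Set.Ioo (-1 : ℝ) 1,
        |(1 / (L : ℝ)) * K L ⌊(L : ℝ) * r⌋ ⌊(L : ℝ) * s⌋ -
          (-(1 - |r - s| - r * s) / (2 * κ))| < ε) ∧
    (∃ C : ℝ, ∃ L₀ : ℕ, ∀ L : ℕ, L₀ < L →
      ∀ r ∈ Set.Ioo (-1 : ℝ) 1, ∀ s ∈ Set.Ioo (-1 : ℝ) 1,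
        |(1 / (L : ℝ)) * K L ⌊(L : ℝ) * r⌋ ⌊(L : ℝ) * s⌋| ≤ C) := by
  have hKeq : ∀ L : ℕ, 1 ≤ L → ∀ x y : ℤ, -(L : ℤ) ≤ x → x ≤ L → -(L : ℤ) ≤ y → y ≤ L →
      K L x y = dirichletKernel w (-L) L x y := by
    intro L hL x y hx1 hx2 hy1 hy2
    by_cases hy : y ∈ Finset.Icc (-(L : ℤ) + 1) ((L : ℤ) - 1)
    · refine sub_eq_zero.1 (eq_zero_of_harmonic hw
        (fun x => K L x y - dirichletKernel w (-L) L x y) (a := -L) (b := L) (by lia) ?_ ?_ ?_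
        hx1 hx2)
      · intro z hz1 hz2
        have h1 := hKinv L hL z (Finset.mem_Icc.2 ⟨by lia, by lia⟩) y hy
        have h2 := dirichletKernel_laplacian hw (by lia : -(L : ℤ) < L) z y
        linear_combination h1 - h2
      · simp only [dirichletKernel_left hy1, sub_zero]
        exact hKsupp L _ _ (Or.inl (by simp))
      · simp only [dirichletKernel_right hy2, sub_zero]
        exact hKsupp L _ _ (Or.inl (by simp))
    · rw [hKsupp L x y (Or.inr hy), dirichletKernel_comm]
      rw [Finset.mem_Icc] at hy
      obtain rfl | rfl : y = -L ∨ y = L := by lia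
      · exact (dirichletKernel_left hx1).symm
      · exact (dirichletKernel_right hx2).symm
  have hconv : ∀ ε > (0 : ℝ), ∃ L₀ : ℕ, ∀ L : ℕ, L₀ < L →
      ∀ r ∈ Set.Ioo (-1 : ℝ) 1, ∀ s ∈ Set.Ioo (-1 : ℝ) 1,
        |(1 / (L : ℝ)) * K L ⌊(L : ℝ) * r⌋ ⌊(L : ℝ) * s⌋ -
          (-(1 - |r - s| - r * s) / (2 * κ))| < ε := by
    intro ε hε
    obtain ⟨L₀, h⟩ := exists_forall_abs_dirichletKernel_sub_lt hw hκ hplus hminus hε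
    refine ⟨L₀, fun L hL r hr s hs => ?_⟩
    obtain ⟨hr1, hr2⟩ := floor_natCast_mul_bounds L hr.1.le hr.2.le
    obtain ⟨hs1, hs2⟩ := floor_natCast_mul_bounds L hs.1.le hs.2.le
    rw [hKeq L (by lia) _ _ hr1 hr2 hs1 hs2]
    exact h L hL r hr s hs
  refine ⟨hconv, ?_⟩
  obtain ⟨L₀, h⟩ := hconv 1 one_pos
  refine ⟨1 + 4 / (2 * κ), L₀, fun L hL r hr s hs => ?_⟩
  have hG : |-(1 - |r - s| - r * s) / (2 * κ)| ≤ 4 / (2 * κ) := by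
    have hm : -1 < min r s := lt_min hr.1 hs.1
    have hm' : min r s < 1 := (min_le_left _ _).trans_lt hr.2
    have hM : -1 < max r s := hr.1.trans_le (le_max_left _ _)
    have hM' : max r s < 1 := max_lt hr.2 hs.2
    rw [abs_div, abs_neg, abs_of_pos (by positivity : 0 < 2 * κ), one_sub_abs_sub_sub_mul,
      abs_of_nonneg (mul_nonneg (by linarith) (by linarith))]
    gcongr
    nlinarith
  have h1 := h L hL r hr s hs
  have h2 := abs_sub_abs_le_abs_sub ((1 / (L : ℝ)) * K L ⌊(L : ℝ) * r⌋ ⌊(L : ℝ) * s⌋)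
    (-(1 - |r - s| - r * s) / (2 * κ))
  linarith
end
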